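/- arXiv:1404.2755 — 2 statements merged into one kernel-verified Lean document; each statement's English description precedes it below -/
import Mathlib

section
/- Let k be a field and let I be a proper radical ideal of R = k[x,y]. Then rt(I) = 1, i.e., I is of linear type. In particular, every reduced affine k-algebra of embedding dimension at most 2 has relation type 1. -/
open Polynomial MvPolynomial

/-- The kernel of the graded presentation `R[t₁,…,t_s] → 𝐑(I) ⊆ R[X]` of the Rees algebra
of the ideal generated by `f`, sending `tᵢ` to `(f i)·X`. -/
noncomputable def reesKer {R : Type*} [CommRing R] {s : ℕ} (f : Fin s → R) :
    Ideal (MvPolynomial (Fin s) R) :=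
  RingHom.ker (MvPolynomial.aeval
    (fun i => Polynomial.C (f i) * Polynomial.X) : MvPolynomial (Fin s) R →ₐ[R] Polynomial R)

/-- `L` is generated by its homogeneous elements of degree at most `N`. -/
def GenInDegLE {R : Type*} [CommRing R] {s : ℕ}
    (L : Ideal (MvPolynomial (Fin s) R)) (N : ℕ) : Prop :=
  L = Ideal.span {p | p ∈ L ∧ ∃ q ≤ N, MvPolynomial.IsHomogeneous p q}

/-- The relation type of an ideal `I`: the least `N ≥ 1` such that, for every finite
generating family of `I`, the ideal of equations of the corresponding presentation of the
Rees algebra is generated by its homogeneous elements of degree at most `N`. -/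
noncomputable def relType {R : Type*} [CommRing R] (I : Ideal R) : ℕ :=
  sInf {N | 1 ≤ N ∧ ∀ (s : ℕ) (f : Fin s → R),
    Ideal.span (Set.range f) = I → GenInDegLE (reesKer f) N}

section TwoGenerated

/-- Among the elements of an ideal of `A[X]`, the primitive part of one of least degree divides
all the others. -/
theorem primPart_dvd_of_forall_natDegree_le {A : Type*} [CommRing A] [IsDomain A]
    [NormalizedGCDMonoid A] {I : Ideal (Polynomial A)} {f : Polynomial A}
    (hf : f ∈ I) (hf0 : f ≠ 0) (hmin : ∀ h ∈ I, h ≠ 0 → f.natDegree ≤ h.natDegree) :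
    ∀ h ∈ I, f.primPart ∣ h := by
  suffices ∀ n, ∀ h ∈ I, h.natDegree = n → f.primPart ∣ h from fun h hh => this _ h hh rfl
  intro n
  induction n using Nat.strong_induction_on with
  | _ n ih =>
    rintro h hh rfl
    by_cases h0 : h = 0
    · simp [h0]
    have hle := hmin h hh h0
    have hcI : f.cancelLeads h ∈ I :=
      I.sub_mem (I.mul_mem_left _ hh) (I.mul_mem_left _ hf)
    have hdvd : f.primPart ∣ f.cancelLeads h := by
      rcases Nat.eq_zero_or_pos h.natDegree with hd | hd
      · have hfd : f.natDegree = 0 := by omega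
        obtain ⟨a, rfl⟩ := Polynomial.natDegree_eq_zero.1 hd
        obtain ⟨b, rfl⟩ := Polynomial.natDegree_eq_zero.1 hfd
        simp [Polynomial.cancelLeads, mul_comm]
      · exact ih _ (Polynomial.natDegree_cancelLeads_lt_of_natDegree_le_natDegree hle hd) _ hcI rfl
    have hlc : f.primPart ∣ Polynomial.C f.leadingCoeff * h := by
      rw [Polynomial.cancelLeads, Nat.sub_eq_zero_of_le hle, pow_zero, mul_one] at hdvd
      exact (dvd_sub_left ((Polynomial.primPart_dvd f).mul_left _)).1 hdvd
    have hc0 : Polynomial.C f.leadingCoeff * h ≠ 0 :=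
      mul_ne_zero (by simpa using hf0) h0
    rw [← f.isPrimitive_primPart.dvd_primPart_iff_dvd hc0,
      (Polynomial.associated_primPart_mul hc0).dvd_iff_dvd_right,
      (Polynomial.isUnit_primPart_C f.leadingCoeff).dvd_mul_left,
      f.isPrimitive_primPart.dvd_primPart_iff_dvd h0] at hlc
    exact hlc

variable {A : Type*} [CommRing A] [IsDomain A] [IsPrincipalIdealRing A]

theorem exists_eq_span_pair_of_prime {p : A} (hp : Prime p) (J : Ideal (Polynomial A))
    (hJ : Polynomial.C p ∈ J) : ∃ q, J = Ideal.span {Polynomial.C p, q} := by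
  have hmax : (Ideal.span {p}).IsMaximal :=
    PrincipalIdealRing.isMaximal_of_irreducible hp.irreducible
  let _ := Ideal.Quotient.field (Ideal.span {p})
  set π := Polynomial.mapRingHom (Ideal.Quotient.mk (Ideal.span {p})) with hπ
  have hsurj : Function.Surjective π :=
    Polynomial.map_surjective _ Ideal.Quotient.mk_surjective
  obtain ⟨q', hq'⟩ := (IsPrincipalIdealRing.principal (J.map π)).principal
  rw [Ideal.submodule_span_eq] at hq'
  obtain ⟨q, hqJ, hq⟩ := (Ideal.mem_map_iff_of_surjective π hsurj).1
    (hq' ▸ Ideal.mem_span_singleton_self q')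
  refine ⟨q, le_antisymm (fun j hj => ?_) ?_⟩
  · have hj' := Ideal.mem_map_of_mem π hj
    rw [hq', Ideal.mem_span_singleton] at hj'
    obtain ⟨r', hr'⟩ := hj'
    obtain ⟨r, rfl⟩ := hsurj r'
    have hker : j - q * r ∈ RingHom.ker π := by
      rw [RingHom.mem_ker, map_sub, map_mul, hr', hq, sub_self]
    rw [hπ, Polynomial.ker_mapRingHom, Ideal.mk_ker, Ideal.map_span, Set.image_singleton,
      Ideal.mem_span_singleton] at hker
    obtain ⟨c, hc⟩ := hker
    exact Ideal.mem_span_pair.2 ⟨c, r, by linear_combination -hc⟩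
  · rw [Ideal.span_le]
    rintro x (rfl | rfl)
    exacts [hJ, hqJ]

theorem exists_eq_span_pair_of_squarefree (p : A) (hp : Squarefree p) :
    ∀ J : Ideal (Polynomial A), Polynomial.C p ∈ J → ∃ q, J = Ideal.span {Polynomial.C p, q} := by
  induction p using UniqueFactorizationMonoid.induction_on_prime with
  | h₁ => exact absurd hp not_squarefree_zero
  | h₂ x hx =>
    intro J hJ
    have hu := hx.map (Polynomial.C : A →+* Polynomial A)
    refine ⟨0, ?_⟩
    rw [Ideal.eq_top_of_isUnit_mem _ hJ hu,
      Ideal.eq_top_of_isUnit_mem _ (Ideal.subset_span (Set.mem_insert _ _)) hu]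
  | h₃ a p ha hprime ih =>
    intro J hJ
    obtain ⟨hrel, -, hsq⟩ := squarefree_mul_iff.1 hp
    obtain ⟨u, v, huv⟩ := hrel.isCoprime
    obtain ⟨q₁, hq₁⟩ := exists_eq_span_pair_of_prime hprime (J ⊔ Ideal.span {Polynomial.C p})
      (Ideal.mem_sup_right (Ideal.mem_span_singleton_self _))
    obtain ⟨q₂, hq₂⟩ := ih hsq (J ⊔ Ideal.span {Polynomial.C a})
      (Ideal.mem_sup_right (Ideal.mem_span_singleton_self _))
    have hone : Polynomial.C u * Polynomial.C p + Polynomial.C v * Polynomial.C a =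
        (1 : Polynomial A) := by
      simp [← map_mul, ← map_add, huv]
    rw [map_mul] at hJ ⊢
    refine ⟨Polynomial.C v * Polynomial.C a * q₁ + Polynomial.C u * Polynomial.C p * q₂,
      le_antisymm (fun j hj => ?_) ?_⟩
    · obtain ⟨a₁, b₁, h₁⟩ := Ideal.mem_span_pair.1 (hq₁ ▸ Ideal.mem_sup_left hj)
      obtain ⟨a₂, b₂, h₂⟩ := Ideal.mem_span_pair.1 (hq₂ ▸ Ideal.mem_sup_left hj)
      generalize (Polynomial.C p : Polynomial A) = P, (Polynomial.C a : Polynomial A) = Q,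
        (Polynomial.C u : Polynomial A) = U, (Polynomial.C v : Polynomial A) = V at *
      refine Ideal.mem_span_pair.2 ⟨U * a₂ + V * a₁ + U * V * (b₂ - b₁) * (q₂ - q₁),
        b₂ * U * P + b₁ * V * Q, ?_⟩
      linear_combination U * P * h₂ + V * Q * h₁ + j * hone
        + (b₂ * U * P * q₂ + b₁ * V * Q * q₁) * hone
    · obtain ⟨j₁, hj₁, r₁', hr₁', h₁⟩ := Submodule.mem_sup.1
        (hq₁.symm ▸ Ideal.subset_span (by simp) : q₁ ∈ J ⊔ Ideal.span {Polynomial.C p})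
      obtain ⟨j₂, hj₂, r₂', hr₂', h₂⟩ := Submodule.mem_sup.1
        (hq₂.symm ▸ Ideal.subset_span (by simp) : q₂ ∈ J ⊔ Ideal.span {Polynomial.C a})
      obtain ⟨r₁, rfl⟩ := Ideal.mem_span_singleton.1 hr₁'
      obtain ⟨r₂, rfl⟩ := Ideal.mem_span_singleton.1 hr₂'
      rw [Ideal.span_le]
      rintro x (rfl | rfl)
      · exact hJ
      · have := J.add_mem (J.add_mem (J.mul_mem_left (Polynomial.C v * Polynomial.C a) hj₁)
          (J.mul_mem_left (Polynomial.C u * Polynomial.C p) hj₂))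
          (J.mul_mem_left (Polynomial.C v * r₁ + Polynomial.C u * r₂) hJ)
        rw [SetLike.mem_coe, ← h₁, ← h₂]
        convert this using 1
        ring

/-- Every radical ideal of the polynomial ring in one variable over a principal ideal domain is
generated by two elements. -/
theorem exists_eq_span_pair_of_isRadical (I : Ideal (Polynomial A)) (hI : I.IsRadical) :
    ∃ u v, I = Ideal.span {u, v} := by
  obtain ⟨_⟩ := (inferInstance : Nonempty (NormalizedGCDMonoid A))
  by_cases hbot : I = ⊥
  · exact ⟨0, 0, by simp [hbot]⟩
  have hne : ∃ n, ∃ f ∈ I, f ≠ 0 ∧ f.natDegree = n := by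
    obtain ⟨f, hf, hf0⟩ := Submodule.exists_mem_ne_zero_of_ne_bot hbot
    exact ⟨_, f, hf, hf0, rfl⟩
  classical
  obtain ⟨f, hf, hf0, hfn⟩ := Nat.find_spec hne
  have hdvd := primPart_dvd_of_forall_natDegree_le hf hf0 fun h hh h0 =>
    hfn ▸ Nat.find_min' hne ⟨h, hh, h0, rfl⟩
  set d := f.primPart with hd
  set J : Ideal (Polynomial A) := I.colon {d} with hJdef
  have hJ : ∀ g, g ∈ J ↔ g * d ∈ I := fun g => by
    rw [hJdef, Submodule.mem_colon_singleton, smul_eq_mul]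
  have hJrad : J.IsRadical := by
    rintro g ⟨n, hn⟩
    rw [hJ] at hn ⊢
    refine hI ⟨n + 1, ?_⟩
    convert I.mul_mem_left (g * d ^ n) hn using 1
    ring
  obtain ⟨p, hp⟩ :=
    (IsPrincipalIdealRing.principal (J.comap (Polynomial.C : A →+* Polynomial A))).principal
  rw [Ideal.submodule_span_eq] at hp
  have hcont : f.content ∈ J.comap (Polynomial.C : A →+* Polynomial A) := by
    rw [Ideal.mem_comap, hJ, hd, ← f.eq_C_content_mul_primPart]
    exact hf
  have hp0 : p ≠ 0 := by
    rintro rfl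
    rw [hp, Ideal.mem_span_singleton, zero_dvd_iff, Polynomial.content_eq_zero_iff] at hcont
    exact hf0 hcont
  have hpsq : Squarefree p := by
    rw [← isRadical_iff_squarefree_of_ne_zero hp0, isRadical_iff_span_singleton, ← hp]
    exact hJrad.comap _
  have hpJ : Polynomial.C p ∈ J :=
    Ideal.mem_comap.1 (hp ▸ Ideal.mem_span_singleton_self p)
  obtain ⟨q, hq⟩ := exists_eq_span_pair_of_squarefree p hpsq J hpJ
  have hqJ : q ∈ J := hq ▸ Ideal.subset_span (by simp)
  refine ⟨Polynomial.C p * d, q * d, le_antisymm (fun h hh => ?_) ?_⟩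
  · obtain ⟨w, rfl⟩ := hdvd h hh
    have hw : w ∈ J := (hJ w).2 (by rwa [mul_comm])
    rw [hq] at hw
    obtain ⟨a, b, rfl⟩ := Ideal.mem_span_pair.1 hw
    exact Ideal.mem_span_pair.2 ⟨a, b, by ring⟩
  · rw [Ideal.span_le]
    rintro x (rfl | rfl)
    exacts [(hJ _).1 hpJ, (hJ _).1 hqJ]

end TwoGenerated

/-- Every radical ideal of `k[x, y]` is generated by two elements. -/
theorem MvPolynomial.exists_eq_span_pair_of_isRadical {k : Type*} [Field k]
    (I : Ideal (MvPolynomial (Fin 2) k)) (hI : I.IsRadical) : ∃ u v, I = Ideal.span {u, v} := by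
  have : IsPrincipalIdealRing (MvPolynomial (Fin 1) k) :=
    IsPrincipalIdealRing.of_surjective (MvPolynomial.uniqueAlgEquiv k (Fin 1)).symm
      (MvPolynomial.uniqueAlgEquiv k (Fin 1)).symm.surjective
  let e := (MvPolynomial.finSuccEquiv k 1).toRingEquiv
  obtain ⟨u, v, huv⟩ := _root_.exists_eq_span_pair_of_isRadical (I.comap e.symm) (hI.comap _)
  refine ⟨e.symm u, e.symm v, ?_⟩
  rw [← Set.image_pair, ← Ideal.map_span, ← huv,
    Ideal.map_comap_of_surjective _ e.symm.surjective]

section LinearType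

variable {R : Type*} [CommRing R]

theorem mem_of_aeval_mem {σ : Type*} {L : Ideal (MvPolynomial σ R)} (g : σ → MvPolynomial σ R)
    (hg : ∀ i, MvPolynomial.X i - g i ∈ L) {F : MvPolynomial σ R}
    (hF : MvPolynomial.aeval g F ∈ L) : F ∈ L := by
  have h : (Ideal.Quotient.mkₐ R L).comp (MvPolynomial.aeval g) = Ideal.Quotient.mkₐ R L :=
    MvPolynomial.algHom_ext fun i => by
      simpa using (Ideal.Quotient.eq.2 (hg i)).symm
  have := DFunLike.congr_fun h F
  rw [AlgHom.comp_apply, Ideal.Quotient.mkₐ_eq_mk] at this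
  rwa [← Ideal.Quotient.eq_zero_iff_mem, ← this, Ideal.Quotient.eq_zero_iff_mem]

/-- The homomorphism `R[Y][X] → R[T]` sending `X` to `p T` and `Y` to `q T`. -/
noncomputable def pairHom (p q : R) : Polynomial (Polynomial R) →+* Polynomial R :=
  Polynomial.eval₂RingHom
    (Polynomial.eval₂RingHom Polynomial.C (Polynomial.C q * Polynomial.X))
    (Polynomial.C p * Polynomial.X)

theorem pairHom_X (p q : R) :
    pairHom p q Polynomial.X = Polynomial.C p * Polynomial.X := by
  simp [pairHom]

theorem pairHom_C (p q : R) (g : Polynomial R) :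
    pairHom p q (Polynomial.C g) = g.comp (Polynomial.C q * Polynomial.X) := by
  simp [pairHom, Polynomial.comp]

theorem pairHom_mul (r p q : R) (G : Polynomial (Polynomial R)) :
    pairHom (r * p) (r * q) G = (pairHom p q G).comp (Polynomial.C r * Polynomial.X) := by
  have h : pairHom (r * p) (r * q) =
      (Polynomial.compRingHom (Polynomial.C r * Polynomial.X)).comp (pairHom p q) := by
    refine Polynomial.ringHom_ext' (Polynomial.ringHom_ext' ?_ ?_) ?_
    · ext; simp [pairHom]
    · simp [pairHom]; ring
    · simp [pairHom]; ring
  exact DFunLike.congr_fun h G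

/-- If `p` and `q` have no common factor, the equations of the Rees algebra of `(p, q)` are the
multiples of `p Y - q X`. -/
theorem dvd_of_pairHom_eq_zero [IsDomain R] [DecompositionMonoid R] {p q : R} (hp : p ≠ 0)
    (hpq : IsRelPrime p q) (G : Polynomial (Polynomial R)) (hG : pairHom p q G = 0) :
    Polynomial.C (Polynomial.C p * Polynomial.X) - Polynomial.C (Polynomial.C q) * Polynomial.X ∣ G := by
  suffices ∀ n, ∀ G : Polynomial (Polynomial R), (∀ i j, n ≤ i + j → (G.coeff i).coeff j = 0) →
      pairHom p q G = 0 →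
        Polynomial.C (Polynomial.C p * Polynomial.X) - Polynomial.C (Polynomial.C q) * Polynomial.X ∣ G by
    refine this (G.natDegree + 1 + ∑ i ∈ Finset.range (G.natDegree + 1),
      ((G.coeff i).natDegree + 1)) G (fun i j hij => ?_) hG
    by_cases hi : G.natDegree < i
    · simp [Polynomial.coeff_eq_zero_of_natDegree_lt hi]
    · refine Polynomial.coeff_eq_zero_of_natDegree_lt ?_
      have := Finset.single_le_sum (f := fun i => (G.coeff i).natDegree + 1)
        (fun _ _ => Nat.zero_le _) (Finset.mem_range.2 (show i < G.natDegree + 1 by omega))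
      omega
  intro n
  induction n with
  | zero =>
    intro G hn _
    have : G = 0 := by
      ext i j
      simpa using hn i j (Nat.zero_le _)
    simp [this]
  | succ n ih =>
    intro G hn hG
    have hdiv := G.divX_mul_X_add
    have hcoeff : ∀ j, (pairHom p q G.divX * (Polynomial.C p * Polynomial.X)).coeff j +
        (G.coeff 0).coeff j * q ^ j = 0 := by
      intro j
      have h := congrArg (fun G => (pairHom p q G).coeff j) hdiv
      beta_reduce at h
      rw [hG, map_add, map_mul, pairHom_X, pairHom_C, Polynomial.coeff_add,
        Polynomial.comp_C_mul_X_coeff] at h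
      simpa using h
    have hdvd : Polynomial.C p ∣ G.coeff 0 := by
      refine (Polynomial.C_dvd_iff_dvd_coeff _ _).2 fun j => ?_
      refine hpq.pow_right.dvd_of_dvd_mul_right (z := q ^ j) ?_
      rw [eq_neg_of_add_eq_zero_right (hcoeff j), dvd_neg, mul_left_comm, Polynomial.coeff_C_mul]
      exact dvd_mul_right _ _
    obtain ⟨g, hg⟩ := hdvd
    have hg0 : g.coeff 0 = 0 := by
      have h := hcoeff 0
      rw [← mul_assoc, Polynomial.coeff_mul_X_zero, hg, Polynomial.coeff_C_mul, pow_zero,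
        mul_one, zero_add] at h
      exact (mul_eq_zero.1 h).resolve_left hp
    obtain ⟨H, rfl⟩ := Polynomial.X_dvd_iff.2 hg0
    have key : G = Polynomial.C H *
        (Polynomial.C (Polynomial.C p * Polynomial.X) - Polynomial.C (Polynomial.C q) * Polynomial.X)
        + (G.divX + Polynomial.C (Polynomial.C q * H)) * Polynomial.X := by
      conv_lhs => rw [← hdiv, hg]
      simp only [map_mul]
      ring
    rw [key]
    refine dvd_add (dvd_mul_left _ _) (Dvd.dvd.mul_right (ih _ (fun i j hij => ?_) ?_) _)
    · have hd : (G.divX.coeff i).coeff j = 0 := by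
        rw [Polynomial.coeff_divX]
        exact hn _ _ (by omega)
      rw [Polynomial.coeff_add, Polynomial.coeff_add, hd, zero_add]
      rcases Nat.eq_zero_or_pos i with rfl | hi
      · have h := hn 0 (j + 1) (by omega)
        rw [hg, Polynomial.coeff_C_mul, Polynomial.coeff_X_mul] at h
        rw [Polynomial.coeff_C_zero, Polynomial.coeff_C_mul, (mul_eq_zero.1 h).resolve_left hp,
          mul_zero]
      · rw [Polynomial.coeff_C_of_ne_zero hi.ne', Polynomial.coeff_zero]
    · have h := congrArg (pairHom p q) key
      rw [hG, map_add, map_mul (pairHom p q), map_mul (pairHom p q), map_sub, map_mul (pairHom p q),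
        pairHom_X, pairHom_C, pairHom_C, pairHom_C] at h
      have h' : pairHom p q (G.divX + Polynomial.C (Polynomial.C q * H)) *
          (Polynomial.C p * Polynomial.X) = 0 := by
        simp only [Polynomial.mul_comp, Polynomial.C_comp, Polynomial.X_comp] at h
        linear_combination -h
      exact (mul_eq_zero.1 h').resolve_right
        (mul_ne_zero (Polynomial.C_ne_zero.2 hp) Polynomial.X_ne_zero)

theorem genInDegLE_one_of_forall_eq_zero {s : ℕ} {f : Fin s → R} (hf : ∀ i, f i = 0) :
    GenInDegLE (reesKer f) 1 := by
  refine le_antisymm (fun F hF => ?_) (Ideal.span_le.2 fun p hp => hp.1)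
  refine mem_of_aeval_mem (fun _ => 0) (fun i => Ideal.subset_span ?_) ?_
  · refine ⟨by simp [reesKer, RingHom.mem_ker, hf], 1, le_rfl, ?_⟩
    simpa using MvPolynomial.isHomogeneous_X R i
  · have h : MvPolynomial.constantCoeff F = 0 := by
      simpa [reesKer, RingHom.mem_ker, hf, MvPolynomial.aeval_zero'] using hF
    rw [MvPolynomial.aeval_zero', h, map_zero]
    exact zero_mem _

/-- An ideal generated by two elements of a unique factorization domain is of linear type. -/
theorem genInDegLE_one_of_span_eq_span_pair [IsDomain R] [UniqueFactorizationMonoid R] {s : ℕ}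
    {f : Fin s → R} {u v : R} (hu : u ≠ 0) (hf : Ideal.span (Set.range f) = Ideal.span {u, v}) :
    GenInDegLE (reesKer f) 1 := by
  obtain ⟨_⟩ := (inferInstance : Nonempty (NormalizedGCDMonoid R))
  obtain ⟨p, q, hup, hvq, hpq⟩ := extract_gcd u v
  set g := gcd u v
  have hg : g ≠ 0 := left_ne_zero_of_mul (hup ▸ hu)
  have hp : p ≠ 0 := right_ne_zero_of_mul (hup ▸ hu)
  have hrel : IsRelPrime p q := gcd_isUnit_iff_isRelPrime.1 hpq
  have hcomb : ∀ i, ∃ a b, a * u + b * v = f i := fun i =>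
    Ideal.mem_span_pair.1 (hf ▸ Ideal.subset_span (Set.mem_range_self i))
  choose a b hab using hcomb
  obtain ⟨c, hc⟩ := Ideal.mem_span_range_iff_exists_fun.1
    (hf.symm ▸ Ideal.subset_span (by simp) : u ∈ Ideal.span (Set.range f))
  obtain ⟨d, hd⟩ := Ideal.mem_span_range_iff_exists_fun.1
    (hf.symm ▸ Ideal.subset_span (by simp) : v ∈ Ideal.span (Set.range f))
  set φ : MvPolynomial (Fin s) R →ₐ[R] Polynomial R :=
    MvPolynomial.aeval fun i => Polynomial.C (f i) * Polynomial.X with hφ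
  let lin (c : Fin s → R) : MvPolynomial (Fin s) R := ∑ i, MvPolynomial.C (c i) * MvPolynomial.X i
  have hlin (c) : (lin c).IsHomogeneous 1 :=
    MvPolynomial.IsHomogeneous.sum _ _ _ fun i _ => MvPolynomial.isHomogeneous_C_mul_X _ _
  have hφlin (c) : φ (lin c) = Polynomial.C (∑ i, c i * f i) * Polynomial.X := by
    simp [lin, hφ, Finset.sum_mul, mul_assoc]
  let P := lin c
  let Q := lin d
  have hP : φ P = Polynomial.C u * Polynomial.X := by rw [hφlin, hc]
  have hQ : φ Q = Polynomial.C v * Polynomial.X := by rw [hφlin, hd]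
  let ψ : MvPolynomial (Fin s) R →+* Polynomial (Polynomial R) :=
    MvPolynomial.eval₂Hom (Polynomial.C.comp Polynomial.C) fun i =>
      Polynomial.C (Polynomial.C (a i)) * Polynomial.X +
        Polynomial.C (Polynomial.C (b i) * Polynomial.X)
  let ξ : Polynomial (Polynomial R) →+* MvPolynomial (Fin s) R :=
    Polynomial.eval₂RingHom (Polynomial.eval₂RingHom MvPolynomial.C Q) P
  have hξψ (F) : MvPolynomial.aeval
      (fun i => MvPolynomial.C (a i) * P + MvPolynomial.C (b i) * Q) F = ξ (ψ F) := by
    induction F using MvPolynomial.induction_on with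
    | C r => simp [ξ, ψ, MvPolynomial.algebraMap_eq]
    | add F G hF hG => simp only [map_add, hF, hG]
    | mul_X F i hF =>
      rw [map_mul, map_mul, map_mul, hF]
      simp [ξ, ψ]
  have hψ (F) : pairHom u v (ψ F) = φ F := by
    induction F using MvPolynomial.induction_on with
    | C r => simp [ψ, hφ, pairHom]
    | add F G hF hG => simp only [map_add, hF, hG]
    | mul_X F i hF =>
      rw [map_mul, map_mul, map_mul, hF]
      congr 1
      simp only [ψ, hφ, pairHom, ← hab]
      simp
      ring
  refine le_antisymm (fun F hF => ?_) (Ideal.span_le.2 fun p hp => hp.1)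
  refine mem_of_aeval_mem (fun i => MvPolynomial.C (a i) * P + MvPolynomial.C (b i) * Q)
    (fun i => Ideal.subset_span ?_) ?_
  · refine ⟨?_, 1, le_rfl,
      (MvPolynomial.isHomogeneous_X R i).sub (((hlin c).C_mul _).add ((hlin d).C_mul _))⟩
    change φ _ = 0
    simp only [map_sub, map_add, map_mul, hP, hQ, MvPolynomial.algHom_C]
    rw [hφ, MvPolynomial.aeval_X, ← hab]
    simp only [map_add, map_mul, ← Polynomial.C_eq_algebraMap]
    ring
  · have hker : pairHom p q (ψ F) = 0 := by
      have h : φ F = 0 := hF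
      rw [← hψ, hup, hvq, pairHom_mul] at h
      ext j
      simpa [hg] using congrArg (Polynomial.coeff · j) h
    obtain ⟨w, hw⟩ := dvd_of_pairHom_eq_zero hp hrel _ hker
    rw [hξψ, hw, map_mul]
    refine Ideal.mul_mem_right _ _ (Ideal.subset_span ⟨?_, 1, le_rfl, ?_⟩)
    · change φ _ = 0
      simp only [ξ, map_sub, map_mul, Polynomial.coe_eval₂RingHom, Polynomial.eval₂_C,
        Polynomial.eval₂_X, hP, hQ, MvPolynomial.algHom_C, ← Polynomial.C_eq_algebraMap]
      rw [hup, hvq]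
      simp only [map_mul]
      ring
    · simp only [ξ, map_sub, map_mul, Polynomial.coe_eval₂RingHom, Polynomial.eval₂_C,
        Polynomial.eval₂_X]
      exact ((hlin d).C_mul _).sub ((hlin c).C_mul _)

end LinearType

/-- Every proper radical ideal `I` of `k[x,y]` has relation type `1`, i.e. `I` is of linear
type. In particular, every reduced affine `k`-algebra of embedding dimension at most `2` has
relation type `1`. -/
theorem relType_radical_two_variables {k : Type*} [Field k]
    (I : Ideal (MvPolynomial (Fin 2) k)) (hI : I ≠ ⊤) (hrad : I.IsRadical) :
    relType I = 1 := by
  have hone : ∀ (s : ℕ) (f : Fin s → MvPolynomial (Fin 2) k),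
      Ideal.span (Set.range f) = I → GenInDegLE (reesKer f) 1 := by
    intro s f hf
    obtain ⟨u, v, rfl⟩ := MvPolynomial.exists_eq_span_pair_of_isRadical I hrad
    by_cases hu : u = 0
    · by_cases hv : v = 0
      · refine genInDegLE_one_of_forall_eq_zero fun i => ?_
        have hi := hf ▸ Ideal.subset_span (Set.mem_range_self i)
        simpa [hu, hv] using hi
      · exact genInDegLE_one_of_span_eq_span_pair hv (Set.pair_comm u v ▸ hf)
    · exact genInDegLE_one_of_span_eq_span_pair hu hf
  exact le_antisymm (Nat.sInf_le ⟨le_rfl, hone⟩) (le_csInf ⟨1, le_rfl, hone⟩ fun N hN => hN.1)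
end

section
/- Let k be a field, n ≥ 3, and let I be a proper radical ideal of R = k[x_1,…,x_n] with equidimensional decomposition I = I_1 ∩ … ∩ I_n associated to an irredundant primary decomposition (where I_i is the intersection of the primary components of I of height i, and I_i = R if there are none). Then either rt(I) = 1, or rt(I) = rt(I_2 ∩ … ∩ I_{n−1}) with I_i ≠ R for some i with 2 ≤ i ≤ n−1. -/
open Polynomial MvPolynomial

/-- The height of an ideal `J` of `R`: the infimum of the heights (in the sense of lengths of
chains in `Spec R`) of the primes containing `J`. -/
noncomputable def idealHeight {R : Type*} [CommRing R] (J : Ideal R) : ℕ∞ :=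
  ⨅ P : {P : PrimeSpectrum R // J ≤ P.asIdeal}, Order.height P.1

/-- For a radical ideal `I`, the `i`-th equidimensional component of `I`: the intersection of
the (primary = prime, since `I` is radical) components of `I` of height `i`, i.e. of the minimal
primes of `I` of height `i`; it equals `R` (the whole ring) if there are none. -/
noncomputable def equidimComponent {R : Type*} [CommRing R] (I : Ideal R) (i : ℕ) : Ideal R :=
  sInf {P | P ∈ I.minimalPrimes ∧ idealHeight P = (i : ℕ∞)}

/-- The ideal generated by the homogeneous equations of degree at most `N`. -/
noncomputable def reesKerLE {R : Type*} [CommRing R] {s : ℕ} (f : Fin s → R) (N : ℕ) :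
    Ideal (MvPolynomial (Fin s) R) :=
  Ideal.span {p | p ∈ reesKer f ∧ ∃ q ≤ N, MvPolynomial.IsHomogeneous p q}

section Rees

variable {R : Type*} [CommRing R] {s t : ℕ}

lemma aeval_C_mul_X_of_isHomogeneous (f : Fin s → R) {p : MvPolynomial (Fin s) R} {q : ℕ}
    (hp : p.IsHomogeneous q) :
    MvPolynomial.aeval (fun i => Polynomial.C (f i) * Polynomial.X) p =
      Polynomial.C (MvPolynomial.eval f p) * Polynomial.X ^ q := by
  rw [MvPolynomial.aeval_def, MvPolynomial.eval₂_eq, MvPolynomial.eval_eq, map_sum,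
    Finset.sum_mul]
  refine Finset.sum_congr rfl fun d hd => ?_
  have hdeg : ∑ i ∈ d.support, d i = q :=
    (hp.degree_eq_sum_deg_support hd).symm
  simp_rw [mul_pow, Finset.prod_mul_distrib, Finset.prod_pow_eq_pow_sum, hdeg, map_mul, map_prod,
    map_pow, Polynomial.algebraMap_eq, mul_assoc]

lemma coeff_aeval_C_mul_X (f : Fin s → R) (p : MvPolynomial (Fin s) R) (q : ℕ) :
    (MvPolynomial.aeval (fun i => Polynomial.C (f i) * Polynomial.X) p : Polynomial R).coeff q =
      MvPolynomial.eval f (MvPolynomial.homogeneousComponent q p) := by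
  conv_lhs => rw [← MvPolynomial.sum_homogeneousComponent p]
  rw [map_sum, Polynomial.finsetSum_coeff]
  simp_rw [aeval_C_mul_X_of_isHomogeneous f
    (MvPolynomial.homogeneousComponent_isHomogeneous _ p), Polynomial.coeff_C_mul_X_pow]
  rw [Finset.sum_ite_eq]
  split_ifs with h
  · rfl
  · rw [MvPolynomial.homogeneousComponent_eq_zero _ _ (by simpa using h), map_zero]

lemma mem_reesKer_iff (f : Fin s → R) (p : MvPolynomial (Fin s) R) :
    p ∈ reesKer f ↔
      ∀ q, MvPolynomial.eval f (MvPolynomial.homogeneousComponent q p) = 0 := by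
  rw [reesKer, RingHom.mem_ker, Polynomial.ext_iff]
  exact forall_congr' fun q => by rw [← coeff_aeval_C_mul_X f p q, Polynomial.coeff_zero]

lemma mem_reesKer_iff_of_isHomogeneous (f : Fin s → R) {p : MvPolynomial (Fin s) R} {q : ℕ}
    (hp : p.IsHomogeneous q) : p ∈ reesKer f ↔ MvPolynomial.eval f p = 0 := by
  rw [reesKer, RingHom.mem_ker]
  change MvPolynomial.aeval _ p = 0 ↔ _
  rw [aeval_C_mul_X_of_isHomogeneous f hp, Polynomial.C_mul_X_pow_eq_monomial,
    Polynomial.monomial_eq_zero_iff]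

lemma mem_reesKerLE_of_isHomogeneous {f : Fin s → R} {p : MvPolynomial (Fin s) R} {q N : ℕ}
    (hq : q ≤ N) (hp : p.IsHomogeneous q) (h : MvPolynomial.eval f p = 0) :
    p ∈ reesKerLE f N :=
  Ideal.subset_span ⟨(mem_reesKer_iff_of_isHomogeneous f hp).2 h, q, hq, hp⟩

lemma genInDegLE_reesKer_iff (f : Fin s → R) (N : ℕ) :
    GenInDegLE (reesKer f) N ↔ ∀ (q : ℕ) (p : MvPolynomial (Fin s) R), p.IsHomogeneous q →
      MvPolynomial.eval f p = 0 → p ∈ reesKerLE f N := by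
  constructor
  · intro h q p hp hp0
    have := (mem_reesKer_iff_of_isHomogeneous f hp).2 hp0
    rwa [h] at this
  · intro h
    refine le_antisymm (fun p hp => ?_) (Ideal.span_le.2 fun p hp => hp.1)
    rw [← MvPolynomial.sum_homogeneousComponent p]
    exact Ideal.sum_mem _ fun q _ => h q _
      (MvPolynomial.homogeneousComponent_isHomogeneous q p) ((mem_reesKer_iff f p).1 hp q)

lemma eval_aeval_of_eval_eq_mul {f : Fin s → R} {g : Fin t → R} {c : R}
    {a : Fin s → MvPolynomial (Fin t) R} (ha : ∀ i, MvPolynomial.eval g (a i) = c * f i) {q : ℕ}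
    {p : MvPolynomial (Fin s) R} (hp : p.IsHomogeneous q) :
    MvPolynomial.eval g (MvPolynomial.aeval a p) = c ^ q * MvPolynomial.eval f p := by
  rw [MvPolynomial.aeval_def, MvPolynomial.eval₂_eq, MvPolynomial.eval_eq f p, map_sum,
    Finset.mul_sum]
  refine Finset.sum_congr rfl fun d hd => ?_
  simp_rw [map_mul, map_prod, map_pow, ha, mul_pow, Finset.prod_mul_distrib,
    Finset.prod_pow_eq_pow_sum, ← hp.degree_eq_sum_deg_support hd,
    MvPolynomial.algebraMap_eq, MvPolynomial.eval_C]
  ring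

/-- If `r I ⊆ J` and `r J ⊆ I`, then a power of `r` moves the equations of `I` into the ideal
generated by those of degree at most `N`, whenever the equations of `J` are generated in degree
at most `N`. -/
lemma C_pow_mul_mem_reesKerLE {f : Fin s → R} {g : Fin t → R} {r : R} {N : ℕ} (hN : 1 ≤ N)
    (hfg : ∀ i, r * f i ∈ Ideal.span (Set.range g))
    (hgf : ∀ j, r * g j ∈ Ideal.span (Set.range f))
    (hg : GenInDegLE (reesKer g) N) {q : ℕ} {p : MvPolynomial (Fin s) R}
    (hp : p.IsHomogeneous q) (hp0 : MvPolynomial.eval f p = 0) :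
    MvPolynomial.C (r ^ (q + q)) * p ∈ reesKerLE f N := by
  simp_rw [Ideal.mem_span_iff_exists_isHomogeneous] at hfg hgf
  choose a ha ha' using hfg
  choose b hb hb' using hgf
  have h1 : MvPolynomial.aeval a p ∈ reesKerLE g N := by
    have := (genInDegLE_reesKer_iff g N).1 hg (1 * q) _ (hp.aeval a ha)
    exact this (by rw [eval_aeval_of_eval_eq_mul ha' hp, hp0, mul_zero])
  have h2 : MvPolynomial.aeval b (MvPolynomial.aeval a p) ∈ reesKerLE f N := by
    have hle : reesKerLE g N ≤ (reesKerLE f N).comap (MvPolynomial.aeval b) := by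
      refine Ideal.span_le.2 ?_
      rintro P ⟨hP, w, hw, hPw⟩
      refine mem_reesKerLE_of_isHomogeneous (q := 1 * w) (by omega) (hPw.aeval b hb) ?_
      rw [eval_aeval_of_eval_eq_mul hb' hPw, (mem_reesKer_iff_of_isHomogeneous g hPw).1 hP, mul_zero]
    exact hle h1
  have h3 : ∀ i, MvPolynomial.aeval b (a i) - MvPolynomial.C (r ^ 2) * MvPolynomial.X i ∈
      reesKerLE f N := by
    intro i
    refine mem_reesKerLE_of_isHomogeneous hN
      (((ha i).aeval b hb).sub ((MvPolynomial.isHomogeneous_X R i).C_mul _)) ?_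
    rw [map_sub, eval_aeval_of_eval_eq_mul hb' (ha i), ha' i]
    simp only [map_mul, MvPolynomial.eval_C, MvPolynomial.eval_X]
    ring
  have h4 : Ideal.Quotient.mk (reesKerLE f N) (MvPolynomial.aeval b (MvPolynomial.aeval a p)) =
      Ideal.Quotient.mk (reesKerLE f N)
        (MvPolynomial.aeval (fun i => MvPolynomial.C (r ^ 2) * MvPolynomial.X i) p) := by
    have h5 : (Ideal.Quotient.mkₐ R (reesKerLE f N)).comp
        ((MvPolynomial.aeval b).comp (MvPolynomial.aeval a)) =
        (Ideal.Quotient.mkₐ R (reesKerLE f N)).comp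
        (MvPolynomial.aeval (fun i => MvPolynomial.C (r ^ 2) * MvPolynomial.X i)) := by
      refine MvPolynomial.algHom_ext fun i => ?_
      simpa using Ideal.Quotient.eq.2 (h3 i)
    exact DFunLike.congr_fun h5 p
  have h6 : MvPolynomial.aeval (fun i => MvPolynomial.C (r ^ 2) * MvPolynomial.X i) p =
      MvPolynomial.C (r ^ (q + q)) * p := by
    conv_rhs => rw [p.as_sum]
    rw [MvPolynomial.aeval_def, MvPolynomial.eval₂_eq, Finset.mul_sum]
    refine Finset.sum_congr rfl fun d hd => ?_
    simp_rw [mul_pow, Finset.prod_mul_distrib, Finset.prod_pow_eq_pow_sum,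
      ← hp.degree_eq_sum_deg_support hd, MvPolynomial.monomial_eq, ← map_pow,
      MvPolynomial.algebraMap_eq, Finsupp.prod, ← two_mul, pow_mul]
    ring
  rw [h6, Ideal.Quotient.eq] at h4
  exact (Submodule.sub_mem_iff_right _ h2).1 h4

end Rees

/-- The equations of every finite presentation of the Rees algebra of `I` are generated in degree
at most `N`. -/
def RelTypeLE {R : Type*} [CommRing R] (I : Ideal R) (N : ℕ) : Prop :=
  ∀ (s : ℕ) (f : Fin s → R), Ideal.span (Set.range f) = I → GenInDegLE (reesKer f) N

section RelTypeLE

variable {R : Type*} [CommRing R] {N : ℕ}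

lemma relType_congr {I J : Ideal R} (h : ∀ N, 1 ≤ N → (RelTypeLE I N ↔ RelTypeLE J N)) :
    relType I = relType J := by
  unfold relType
  congr 1
  ext N
  exact and_congr_right (h N)

lemma relType_eq_one {I : Ideal R} (h : RelTypeLE I 1) : relType I = 1 :=
  le_antisymm (Nat.sInf_le ⟨le_rfl, h⟩) (le_csInf ⟨1, le_rfl, h⟩ fun _ hN => hN.1)

lemma GenInDegLE.mono {s : ℕ} {L : Ideal (MvPolynomial (Fin s) R)} {M : ℕ}
    (h : GenInDegLE L M) (hMN : M ≤ N) : GenInDegLE L N := by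
  refine le_antisymm (h.le.trans (Ideal.span_mono ?_)) (Ideal.span_le.2 fun p hp => hp.1)
  rintro p ⟨hp, q, hq, hpq⟩
  exact ⟨hp, q, hq.trans hMN, hpq⟩

lemma GenInDegLE.relTypeLE {s : ℕ} {f : Fin s → R} (hN : 1 ≤ N)
    (h : GenInDegLE (reesKer f) N) : RelTypeLE (Ideal.span (Set.range f)) N := by
  intro t g hg
  rw [genInDegLE_reesKer_iff]
  intro q p hp hp0
  have := C_pow_mul_mem_reesKerLE (f := g) (g := f) (r := 1) hN
    (fun i => by rw [← hg, one_mul]; exact Ideal.subset_span ⟨i, rfl⟩)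
    (fun i => by rw [hg, one_mul]; exact Ideal.subset_span ⟨i, rfl⟩) h hp hp0
  simpa using this

lemma relTypeLE_of_isCoprime {I J₁ J₂ : Ideal R} (h₁ : J₁.FG) (h₂ : J₂.FG) (hN : 1 ≤ N)
    {r₁ r₂ : R} (hr : IsCoprime r₁ r₂)
    (h₁I : ∀ x ∈ I, r₁ * x ∈ J₁) (hI₁ : ∀ x ∈ J₁, r₁ * x ∈ I)
    (h₂I : ∀ x ∈ I, r₂ * x ∈ J₂) (hI₂ : ∀ x ∈ J₂, r₂ * x ∈ I)
    (hJ₁ : RelTypeLE J₁ N) (hJ₂ : RelTypeLE J₂ N) : RelTypeLE I N := by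
  obtain ⟨t₁, g₁, rfl⟩ := Submodule.fg_iff_exists_fin_generating_family.1 h₁
  obtain ⟨t₂, g₂, rfl⟩ := Submodule.fg_iff_exists_fin_generating_family.1 h₂
  rintro s f rfl
  rw [genInDegLE_reesKer_iff]
  intro q p hp hp0
  have m₁ := C_pow_mul_mem_reesKerLE (r := r₁) hN
    (fun i => h₁I _ (Ideal.subset_span ⟨i, rfl⟩))
    (fun i => hI₁ _ (Submodule.subset_span ⟨i, rfl⟩)) (hJ₁ _ _ rfl) hp hp0
  have m₂ := C_pow_mul_mem_reesKerLE (r := r₂) hN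
    (fun i => h₂I _ (Ideal.subset_span ⟨i, rfl⟩))
    (fun i => hI₂ _ (Submodule.subset_span ⟨i, rfl⟩)) (hJ₂ _ _ rfl) hp hp0
  obtain ⟨a, b, hab⟩ := hr.pow (m := q + q) (n := q + q)
  have : p = MvPolynomial.C a * (MvPolynomial.C (r₁ ^ (q + q)) * p) +
      MvPolynomial.C b * (MvPolynomial.C (r₂ ^ (q + q)) * p) := by
    rw [← mul_assoc, ← mul_assoc, ← add_mul, ← map_mul, ← map_mul, ← map_add, hab, map_one,
      one_mul]
  rw [this]
  exact Ideal.add_mem _ (Ideal.mul_mem_left _ _ m₁) (Ideal.mul_mem_left _ _ m₂)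

lemma relTypeLE_inf_iff [IsNoetherianRing R] {P K : Ideal R} (hN : 1 ≤ N) (hPK : P ⊔ K = ⊤)
    (hP : RelTypeLE P N) (htop : RelTypeLE (⊤ : Ideal R) N) :
    RelTypeLE (P ⊓ K) N ↔ RelTypeLE K N := by
  obtain ⟨x, hx, y, hy, hxy⟩ := Submodule.mem_sup.1 ((Ideal.eq_top_iff_one _).1 hPK)
  have hco : IsCoprime x y := ⟨1, 1, by rw [one_mul, one_mul, hxy]⟩
  constructor
  · intro h
    exact relTypeLE_of_isCoprime (I := K) (J₁ := P ⊓ K) (J₂ := ⊤) (IsNoetherian.noetherian _)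
      (IsNoetherian.noetherian _) hN hco
      (fun z hz => ⟨P.mul_mem_right _ hx, K.mul_mem_left _ hz⟩)
      (fun z hz => K.mul_mem_left _ hz.2)
      (fun z _ => Submodule.mem_top) (fun z _ => K.mul_mem_right _ hy) h htop
  · intro h
    exact relTypeLE_of_isCoprime (I := P ⊓ K) (J₁ := K) (J₂ := P) (IsNoetherian.noetherian _)
      (IsNoetherian.noetherian _) hN hco
      (fun z hz => K.mul_mem_left _ hz.2)
      (fun z hz => ⟨P.mul_mem_right _ hx, K.mul_mem_left _ hz⟩)
      (fun z hz => P.mul_mem_left _ hz.1)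
      (fun z hz => ⟨P.mul_mem_left _ hz, K.mul_mem_right _ hy⟩) h hP

lemma reesKer_const_mul [IsDomain R] {s : ℕ} {c : R} (hc : c ≠ 0) (f : Fin s → R) :
    reesKer (fun i => c * f i) = reesKer f := by
  ext p
  simp_rw [mem_reesKer_iff]
  refine forall_congr' fun q => ?_
  have := eval_aeval_of_eval_eq_mul (f := f) (g := fun i => c * f i) (c := c)
    (a := MvPolynomial.X) (fun i => by simp)
    (MvPolynomial.homogeneousComponent_isHomogeneous q p)
  rw [MvPolynomial.aeval_X_left_apply] at this
  rw [this, mul_eq_zero, or_iff_right (pow_ne_zero q hc)]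

lemma relTypeLE_span_singleton_mul_iff [IsDomain R] {c : R} (hc : c ≠ 0) (K : Ideal R) :
    RelTypeLE (Ideal.span {c} * K) N ↔ RelTypeLE K N := by
  have hspan : ∀ {s : ℕ} (f : Fin s → R), Ideal.span (Set.range fun i => c * f i) =
      Ideal.span {c} * Ideal.span (Set.range f) := by
    intro s f
    rw [Ideal.span_mul_span', Set.singleton_mul, ← Set.range_comp]
    rfl
  constructor
  · rintro h s f rfl
    rw [← reesKer_const_mul hc]
    exact h s _ (hspan f)
  · intro h s f hf
    have : ∀ i, ∃ z ∈ K, c * z = f i := fun i =>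
      Ideal.mem_span_singleton_mul.1 (hf ▸ Ideal.subset_span ⟨i, rfl⟩)
    choose g _ hg' using this
    obtain rfl : (fun i => c * g i) = f := funext hg'
    rw [reesKer_const_mul hc]
    refine h s g ?_
    rw [hspan] at hf
    exact (Ideal.span_singleton_mul_right_inj hc).1 hf

end RelTypeLE

section LinearType

variable {R S : Type*} [CommRing R] [CommRing S] {s : ℕ}

lemma genInDegLE_reesKer_of_isEmpty (f : Fin 0 → R) (N : ℕ) : GenInDegLE (reesKer f) N := by
  rw [genInDegLE_reesKer_iff]
  intro q p _ hp0
  rw [MvPolynomial.eq_C_of_isEmpty p, MvPolynomial.eval_C] at hp0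
  rw [MvPolynomial.eq_C_of_isEmpty p, hp0, map_zero]
  exact Ideal.zero_mem _

lemma reesKerLE_le_reesKer (f : Fin s → R) (N : ℕ) : reesKerLE f N ≤ reesKer f :=
  Ideal.span_le.2 fun _ hp => hp.1

lemma aeval_rename_succ_cons (f : Fin s → R) (g : R) (p : MvPolynomial (Fin s) R) :
    (MvPolynomial.aeval (fun i => Polynomial.C ((Fin.cons g f : Fin (s + 1) → R) i) *
      Polynomial.X) (MvPolynomial.rename Fin.succ p) : Polynomial R) =
      MvPolynomial.aeval (fun i => Polynomial.C (f i) * Polynomial.X) p := by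
  rw [MvPolynomial.aeval_rename]
  rfl

lemma rename_succ_mem_reesKerLE_cons {f : Fin s → R} (g : R) {N : ℕ}
    {p : MvPolynomial (Fin s) R} (hp : p ∈ reesKerLE f N) :
    MvPolynomial.rename Fin.succ p ∈ reesKerLE (Fin.cons g f : Fin (s + 1) → R) N := by
  have hle : reesKerLE f N ≤ (reesKerLE (Fin.cons g f : Fin (s + 1) → R) N).comap
      (MvPolynomial.rename Fin.succ) := by
    refine Ideal.span_le.2 ?_
    rintro P ⟨hP, q, hq, hPq⟩
    refine Ideal.subset_span ⟨?_, q, hq, hPq.rename_isHomogeneous⟩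
    exact (aeval_rename_succ_cons f g P).trans hP
  exact hle hp

lemma exists_X_mul_rename_sub_rename_mem {f : Fin s → R} (g : R) {q : ℕ} {c : R}
    (hc : c ∈ Ideal.span (Set.range f) ^ (q + 1)) :
    ∃ w v : MvPolynomial (Fin s) R,
      MvPolynomial.aeval (fun i => Polynomial.C (f i) * Polynomial.X) w =
        Polynomial.C c * Polynomial.X ^ q ∧
      MvPolynomial.X 0 * MvPolynomial.rename Fin.succ w - MvPolynomial.rename Fin.succ v ∈
        reesKerLE (Fin.cons g f : Fin (s + 1) → R) 1 := by
  rw [pow_succ'] at hc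
  refine Submodule.mul_induction_on hc ?_ ?_
  · intro a ha b hb
    obtain ⟨h, hh, rfl⟩ := (Ideal.mem_span_pow_iff_exists_isHomogeneous f b).1 hb
    obtain ⟨l, hl, hla⟩ := (Ideal.mem_span_iff_exists_isHomogeneous f a).1 ha
    refine ⟨MvPolynomial.C a * h, MvPolynomial.C g * l * h, ?_, ?_⟩
    · rw [map_mul, aeval_C_mul_X_of_isHomogeneous f hh, MvPolynomial.aeval_C, map_mul, mul_assoc]
      rfl
    · have hmem : MvPolynomial.C a * MvPolynomial.X 0 -
          MvPolynomial.C g * MvPolynomial.rename Fin.succ l ∈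
          reesKerLE (Fin.cons g f : Fin (s + 1) → R) 1 := by
        refine mem_reesKerLE_of_isHomogeneous le_rfl
          (((MvPolynomial.isHomogeneous_X R 0).C_mul _).sub (hl.rename_isHomogeneous.C_mul _)) ?_
        have : (Fin.cons g f : Fin (s + 1) → R) ∘ Fin.succ = f := by ext; simp
        simp only [map_sub, map_mul, MvPolynomial.eval_C, MvPolynomial.eval_X,
          MvPolynomial.eval_rename, this, hla, Fin.cons_zero]
        ring
      convert Ideal.mul_mem_right (MvPolynomial.rename Fin.succ h) _ hmem using 1
      simp only [map_mul, MvPolynomial.rename_C]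
      ring
  · rintro x y ⟨w, v, hw, hv⟩ ⟨w', v', hw', hv'⟩
    refine ⟨w + w', v + v', ?_, ?_⟩
    · rw [map_add, hw, hw', map_add, add_mul]
    · convert Ideal.add_mem _ hv hv' using 1
      simp only [map_add]
      ring

/-- Adjoining an element that is regular modulo all powers of an ideal of linear type gives an
ideal of linear type. -/
lemma GenInDegLE.cons {f : Fin s → R} {g : R}
    (hreg : ∀ (q : ℕ) (a : R), g * a ∈ Ideal.span (Set.range f) ^ q →
      a ∈ Ideal.span (Set.range f) ^ q)
    (hf : GenInDegLE (reesKer f) 1) :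
    GenInDegLE (reesKer (Fin.cons g f : Fin (s + 1) → R)) 1 := by
  set Q := reesKerLE (Fin.cons g f : Fin (s + 1) → R) 1 with hQ
  have hQle : Q ≤ reesKer (Fin.cons g f : Fin (s + 1) → R) := reesKerLE_le_reesKer _ _
  have hren : ∀ p : MvPolynomial (Fin s) R,
      MvPolynomial.rename Fin.succ p ∈ reesKer (Fin.cons g f : Fin (s + 1) → R) →
      MvPolynomial.rename Fin.succ p ∈ Q := by
    intro p hp
    refine rename_succ_mem_reesKerLE_cons g ?_
    have : p ∈ reesKer f := (aeval_rename_succ_cons f g p).symm.trans hp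
    rwa [hf] at this
  have hX : (MvPolynomial.finSuccEquiv R s).symm Polynomial.X = MvPolynomial.X 0 := by
    rw [AlgEquiv.symm_apply_eq, MvPolynomial.finSuccEquiv_X_zero]
  have hC : ∀ p, (MvPolynomial.finSuccEquiv R s).symm (Polynomial.C p) =
      MvPolynomial.rename Fin.succ p := by
    intro p
    have : ((MvPolynomial.finSuccEquiv R s : _ →ₐ[R] _).comp (MvPolynomial.rename Fin.succ)) =
        (Polynomial.CAlgHom : MvPolynomial (Fin s) R →ₐ[MvPolynomial (Fin s) R]
          Polynomial (MvPolynomial (Fin s) R)).restrictScalars R := by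
      refine MvPolynomial.algHom_ext fun i => ?_
      simp [MvPolynomial.finSuccEquiv_X_succ]
    exact (AlgEquiv.symm_apply_eq _).2 (DFunLike.congr_fun this p).symm
  have key : ∀ (d : ℕ) (P : Polynomial (MvPolynomial (Fin s) R)), P.natDegree ≤ d →
      (MvPolynomial.finSuccEquiv R s).symm P ∈ reesKer (Fin.cons g f : Fin (s + 1) → R) →
      (MvPolynomial.finSuccEquiv R s).symm P ∈ Q := by
    intro d
    induction d with
    | zero =>
      intro P hd hP
      rw [Polynomial.eq_C_of_natDegree_le_zero hd, hC] at hP ⊢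
      exact hren _ hP
    | succ d ih =>
      intro P hd hP
      set D := (MvPolynomial.finSuccEquiv R s).symm P.divX with hD
      set p₀ := P.coeff 0
      have hPD : (MvPolynomial.finSuccEquiv R s).symm P =
          MvPolynomial.X 0 * D + MvPolynomial.rename Fin.succ p₀ := by
        conv_lhs => rw [← Polynomial.X_mul_divX_add P]
        rw [map_add, map_mul, hX, hC]
      set F : Polynomial R := MvPolynomial.aeval (fun i => Polynomial.C
        ((Fin.cons g f : Fin (s + 1) → R) i) * Polynomial.X) D with hF
      have hcoeff : ∀ q, F.coeff q ∈ Ideal.span (Set.range f) ^ (q + 1) := by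
        intro q
        refine hreg _ _ ?_
        rw [hPD] at hP
        have h0 : Polynomial.C g * Polynomial.X * F + MvPolynomial.aeval
            (fun i => Polynomial.C (f i) * Polynomial.X) p₀ = 0 := by
          rw [← aeval_rename_succ_cons f g p₀, hF]
          have := RingHom.mem_ker.1 hP
          simpa using this
        have h1 := congrArg (fun G => Polynomial.coeff G (q + 1)) h0
        simp only [Polynomial.coeff_add, coeff_aeval_C_mul_X, mul_assoc, Polynomial.coeff_C_mul,
          Polynomial.coeff_X_mul, Polynomial.coeff_zero] at h1
        rw [eq_neg_of_add_eq_zero_left h1]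
        exact Ideal.neg_mem_iff _ |>.2 ((Ideal.mem_span_pow_iff_exists_isHomogeneous f _).2
          ⟨_, MvPolynomial.homogeneousComponent_isHomogeneous _ _, rfl⟩)
      choose w v hw hv using fun q => exists_X_mul_rename_sub_rename_mem g (hcoeff q)
      set W := ∑ q ∈ Finset.range (F.natDegree + 1), w q with hW
      set V := ∑ q ∈ Finset.range (F.natDegree + 1), v q with hV
      have hWF : MvPolynomial.aeval (fun i => Polynomial.C (f i) * Polynomial.X) W = F := by
        rw [hW, map_sum]
        simp_rw [hw]
        exact F.as_sum_range_C_mul_X_pow.symm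
      have hWV : MvPolynomial.X 0 * MvPolynomial.rename Fin.succ W -
          MvPolynomial.rename Fin.succ V ∈ Q := by
        rw [hW, hV, map_sum, map_sum, Finset.mul_sum, ← Finset.sum_sub_distrib]
        exact Ideal.sum_mem _ fun q _ => hv q
      have hDW : D - MvPolynomial.rename Fin.succ W ∈ Q := by
        rw [hD, ← hC, ← map_sub]
        refine ih _ ?_ ?_
        · rw [Polynomial.natDegree_sub_C, Polynomial.natDegree_divX_eq_natDegree_tsub_one]
          omega
        · rw [map_sub, hC, ← hD]
          refine RingHom.mem_ker.2 ?_
          have := aeval_rename_succ_cons f g W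
          rw [hWF] at this
          simpa [sub_eq_zero] using this.symm
      have hsum : (MvPolynomial.finSuccEquiv R s).symm P =
          MvPolynomial.X 0 * (D - MvPolynomial.rename Fin.succ W) +
          (MvPolynomial.X 0 * MvPolynomial.rename Fin.succ W - MvPolynomial.rename Fin.succ V) +
          MvPolynomial.rename Fin.succ (V + p₀) := by
        rw [hPD, map_add]
        ring
      have hmem := Ideal.add_mem _ (Ideal.mul_mem_left _ (MvPolynomial.X 0) hDW) hWV
      rw [hsum] at hP ⊢
      exact Ideal.add_mem _ hmem
        (hren _ ((Submodule.add_mem_iff_right _ (hQle hmem)).1 hP))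
  refine le_antisymm (fun p hp => ?_) hQle
  have := key _ (MvPolynomial.finSuccEquiv R s p) le_rfl (by simpa using hp)
  rwa [AlgEquiv.symm_apply_apply] at this

lemma relTypeLE_top {N : ℕ} (hN : 1 ≤ N) : RelTypeLE (⊤ : Ideal R) N := by
  have h := GenInDegLE.cons (f := (Fin.elim0 : Fin 0 → R)) (g := 1)
    (fun q a ha => by rwa [one_mul] at ha) (genInDegLE_reesKer_of_isEmpty _ 1)
  have := (h.mono hN).relTypeLE hN
  rwa [(Ideal.eq_top_iff_one (Ideal.span (Set.range (Fin.cons 1 Fin.elim0 : Fin 1 → R)))).2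
    (Ideal.subset_span ⟨0, rfl⟩)] at this

lemma map_mem_reesKerLE (σ : R →+* S) {f : Fin s → R} {N : ℕ} {p : MvPolynomial (Fin s) R}
    (hp : p ∈ reesKerLE f N) : MvPolynomial.map σ p ∈ reesKerLE (fun i => σ (f i)) N := by
  have hle : reesKerLE f N ≤ (reesKerLE (fun i => σ (f i)) N).comap (MvPolynomial.map σ) := by
    refine Ideal.span_le.2 ?_
    rintro P ⟨hP, q, hq, hPq⟩
    refine mem_reesKerLE_of_isHomogeneous hq (hPq.map σ) ?_
    have := (mem_reesKer_iff_of_isHomogeneous f hPq).1 hP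
    rw [MvPolynomial.eval_map]
    change MvPolynomial.eval₂ σ (σ ∘ f) P = 0
    rw [← MvPolynomial.eval₂_comp, this, map_zero]
  exact hle hp

lemma GenInDegLE.ringEquiv (e : R ≃+* S) {f : Fin s → R} {N : ℕ}
    (h : GenInDegLE (reesKer f) N) : GenInDegLE (reesKer fun i => e (f i)) N := by
  rw [genInDegLE_reesKer_iff] at h ⊢
  intro q p hp hp0
  have h0 : MvPolynomial.eval f (MvPolynomial.map (e.symm : S →+* R) p) = 0 := by
    have : f = (e.symm : S →+* R) ∘ fun i => e (f i) := by ext i; simp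
    rw [MvPolynomial.eval_map]
    nth_rewrite 1 [this]
    rw [← MvPolynomial.eval₂_comp, hp0, map_zero]
  have := map_mem_reesKerLE (e : R →+* S) (h q _ (hp.map _) h0)
  rwa [MvPolynomial.map_map, RingEquiv.comp_symm, MvPolynomial.map_id] at this

lemma GenInDegLE.polynomial {f : Fin s → R} {N : ℕ} (h : GenInDegLE (reesKer f) N) :
    GenInDegLE (reesKer fun i => (Polynomial.C (f i) : Polynomial R)) N := by
  rw [genInDegLE_reesKer_iff] at h ⊢
  intro q p hp hp0
  set P : ℕ → MvPolynomial (Fin s) R := fun j =>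
    ∑ m ∈ p.support, MvPolynomial.monomial m ((p.coeff m).coeff j) with hP
  have hPcoeff : ∀ j m, (P j).coeff m = (p.coeff m).coeff j := by
    classical
    intro j m
    simp only [hP, MvPolynomial.coeff_sum, MvPolynomial.coeff_monomial, Finset.sum_ite_eq']
    split_ifs with hm
    · rfl
    · rw [MvPolynomial.notMem_support_iff.1 hm, Polynomial.coeff_zero]
  set d := p.support.sup (fun m => (p.coeff m).natDegree) + 1
  have hsum : p = ∑ j ∈ Finset.range d, MvPolynomial.C (Polynomial.X ^ j) *
      MvPolynomial.map Polynomial.C (P j) := by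
    ext1 m
    simp_rw [MvPolynomial.coeff_sum, MvPolynomial.coeff_C_mul, MvPolynomial.coeff_map, hPcoeff]
    by_cases hm : m ∈ p.support
    · have hd : (p.coeff m).natDegree < d :=
        Nat.lt_succ_of_le (Finset.le_sup (f := fun m => (p.coeff m).natDegree) hm)
      refine (Polynomial.as_sum_range_C_mul_X_pow' (p.coeff m) hd).trans ?_
      exact Finset.sum_congr rfl fun _ _ => mul_comm _ _
    · rw [MvPolynomial.notMem_support_iff.1 hm]
      simp
  have heval : ∀ j, MvPolynomial.eval (fun i => (Polynomial.C (f i) : Polynomial R))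
      (MvPolynomial.map Polynomial.C (P j)) = Polynomial.C (MvPolynomial.eval f (P j)) := by
    intro j
    rw [MvPolynomial.eval_map]
    exact (MvPolynomial.eval₂_comp _ _ _).symm
  rw [hsum]
  refine Ideal.sum_mem _ fun j hj => Ideal.mul_mem_left _ _ (map_mem_reesKerLE _ (h q _ ?_ ?_))
  · intro m hm
    rw [hPcoeff] at hm
    exact hp fun h0 => hm (by rw [h0, Polynomial.coeff_zero])
  · rw [hsum, map_sum] at hp0
    simp_rw [map_mul, MvPolynomial.eval_C, heval] at hp0
    have := congrArg (fun G => Polynomial.coeff G j) hp0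
    simp only [Polynomial.finsetSum_coeff, Polynomial.coeff_X_pow_mul', Polynomial.coeff_C,
      Polynomial.coeff_zero] at this
    rw [Finset.sum_eq_single j] at this
    · simpa using this
    · intro i _ hij
      split_ifs <;> first | rfl | omega
    · exact fun h' => absurd hj h'

lemma mem_map_C_of_monic_mul_mem {J : Ideal R} {g a : Polynomial R} (hg : g.Monic)
    (h : g * a ∈ J.map Polynomial.C) : a ∈ J.map Polynomial.C := by
  have hker : ∀ b : Polynomial R, b ∈ J.map Polynomial.C ↔
      b.map (Ideal.Quotient.mk J) = 0 := by
    intro b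
    rw [Ideal.mem_map_C_iff, Polynomial.ext_iff]
    simp [Ideal.Quotient.eq_zero_iff_mem]
  rw [hker] at h ⊢
  rw [Polynomial.map_mul] at h
  exact ((hg.map _).mul_right_eq_zero_iff).1 h

/-- Maximal ideals of a polynomial ring over a field are of linear type. -/
lemma exists_span_eq_genInDegLE_one (k : Type*) [Field k] (n : ℕ)
    (m : Ideal (MvPolynomial (Fin n) k)) (hm : m.IsMaximal) :
    ∃ (s : ℕ) (f : Fin s → MvPolynomial (Fin n) k),
      Ideal.span (Set.range f) = m ∧ GenInDegLE (reesKer f) 1 := by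
  induction n with
  | zero =>
    have hF : IsField (MvPolynomial (Fin 0) k) :=
      (MvPolynomial.isEmptyRingEquiv k (Fin 0)).toMulEquiv.isField (Field.toIsField k)
    let := hF.toField
    refine ⟨0, Fin.elim0, ?_, genInDegLE_reesKer_of_isEmpty _ 1⟩
    rw [Set.range_eq_empty, Ideal.span_empty]
    exact ((Ideal.eq_bot_or_top m).resolve_right hm.ne_top).symm
  | succ n ih =>
    let e := (MvPolynomial.finSuccEquiv k n).toRingEquiv
    set M : Ideal (Polynomial (MvPolynomial (Fin n) k)) := m.comap e.symm with hM
    have hMmax : M.IsMaximal := Ideal.comap_isMaximal_of_equiv e.symm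
    have hmax := Polynomial.isMaximal_comap_C_of_isJacobsonRing M
    have hne : M ≠ (M.comap Polynomial.C).map Polynomial.C := by
      intro heq
      have hcoeff : ∀ p ∈ M, ∀ i, p.coeff i ∈ M.comap Polynomial.C := fun p hp =>
        Ideal.mem_map_C_iff.1 (heq ▸ hp)
      by_cases hX : Polynomial.X ∈ M
      · refine hmax.ne_top ((Ideal.eq_top_iff_one _).2 ?_)
        simpa using hcoeff _ hX 1
      · obtain ⟨y, z, hz, hyz⟩ := hMmax.exists_inv hX
        refine hmax.ne_top ((Ideal.eq_top_iff_one _).2 ?_)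
        have := hcoeff z hz 0
        rw [eq_sub_of_add_eq' hyz] at this
        simpa using this
    obtain ⟨g, hg, hMg⟩ := Polynomial.exists_monic_span_sup_map_eq _ M hmax hne
    obtain ⟨s, f, hf, hgen⟩ := ih _ hmax
    have hspan : Ideal.span (Set.range fun i => (Polynomial.C (f i) : Polynomial _)) =
        (M.comap Polynomial.C).map Polynomial.C := by
      conv_rhs => rw [← hf, Ideal.map_span, ← Set.range_comp]
      rfl
    refine ⟨s + 1, fun i => e.symm ((Fin.cons g fun i => Polynomial.C (f i) :
      Fin (s + 1) → Polynomial (MvPolynomial (Fin n) k)) i), ?_,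
      GenInDegLE.ringEquiv e.symm (GenInDegLE.cons ?_ hgen.polynomial)⟩
    · have h1 : Ideal.span (Set.range (Fin.cons g fun i => Polynomial.C (f i) :
          Fin (s + 1) → Polynomial (MvPolynomial (Fin n) k))) = M := by
        rw [Fin.range_cons, Ideal.span_insert, hspan, sup_comm]
        exact hMg.symm
      have h2 := congrArg (Ideal.map e.symm) h1
      rw [Ideal.map_span, ← Set.range_comp, hM,
        Ideal.map_comap_of_surjective _ e.symm.surjective] at h2
      exact h2
    · intro q a ha
      rw [hspan, ← Ideal.map_pow] at ha ⊢
      exact mem_map_C_of_monic_mul_mem hg ha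

end LinearType

section EquidimensionalComponents

variable {R : Type*} [CommRing R]

lemma idealHeight_eq_height (P : Ideal R) [hP : P.IsPrime] : idealHeight P = P.height := by
  rw [show P.height = Order.height (⟨P, hP⟩ : PrimeSpectrum R) from
    PrimeSpectrum.height_eq_orderHeight ⟨P, hP⟩]
  refine le_antisymm (iInf_le_of_le ⟨⟨P, hP⟩, le_rfl⟩ le_rfl) (le_iInf fun Q => ?_)
  exact Order.height_mono (show (⟨P, hP⟩ : PrimeSpectrum R) ≤ Q.1 from Q.2)

lemma iInf_equidimComponent (I : Ideal R) (s : Finset ℕ) :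
    ⨅ i ∈ s, equidimComponent I i =
      sInf {P | P ∈ I.minimalPrimes ∧ ∃ i ∈ s, idealHeight P = (i : ℕ∞)} := by
  refine le_antisymm (le_sInf ?_) (le_iInf₂ fun i hi => le_sInf ?_)
  · rintro P ⟨hP, i, hi, hPi⟩
    exact (iInf₂_le i hi).trans (sInf_le ⟨hP, hPi⟩)
  · rintro P ⟨hP, hPi⟩
    exact sInf_le ⟨hP, i, hi, hPi⟩

/-- Intersecting with further minimal primes that are principal, or maximal of relation type at
most `N`, does not affect whether the relation type is at most `N`. -/
lemma relTypeLE_sInf_union_iff [IsDomain R] [IsNoetherianRing R] {I : Ideal R} {N : ℕ}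
    (hN : 1 ≤ N) {S T : Set (Ideal R)} (hS : S ⊆ I.minimalPrimes) (hT : T ⊆ I.minimalPrimes)
    (hST : Disjoint S T)
    (h : ∀ P ∈ S, (∃ c ≠ 0, P = Ideal.span {c}) ∨ (P.IsMaximal ∧ RelTypeLE P N)) :
    RelTypeLE (sInf (S ∪ T)) N ↔ RelTypeLE (sInf T) N := by
  have hfin := I.finite_minimalPrimes_of_isNoetherianRing
  induction S, hfin.subset hS using Set.Finite.induction_on with
  | empty => rw [Set.empty_union]
  | @insert P S hPS _ ih =>
    rw [Set.insert_subset_iff] at hS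
    rw [Set.disjoint_insert_left] at hST
    refine Iff.trans ?_ (ih hS.2 hST.2 fun Q hQ => h Q (Set.mem_insert_of_mem _ hQ))
    rw [Set.insert_union, sInf_insert]
    have hUmin : S ∪ T ⊆ I.minimalPrimes := Set.union_subset hS.2 hT
    have hPU : P ∉ S ∪ T := by simp [hPS, hST.1]
    generalize S ∪ T = U at hUmin hPU
    rcases h P (Set.mem_insert _ _) with ⟨c, hc, rfl⟩ | ⟨hmax, hP⟩
    · have hmul : Ideal.span {c} ⊓ sInf U = Ideal.span {c} * sInf U := by
        refine le_antisymm ?_ Ideal.mul_le_inf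
        rintro x ⟨hx, hxU⟩
        obtain ⟨y, rfl⟩ := Ideal.mem_span_singleton'.1 hx
        rw [mul_comm (Ideal.span {c})]
        refine Ideal.mul_mem_mul (Ideal.mem_sInf.2 ?_) (Ideal.mem_span_singleton_self c)
        intro Q hQ
        have hyc : y * c ∈ Q := (sInf_le hQ : sInf U ≤ Q) hxU
        refine ((hUmin hQ).1.1.mem_or_mem hyc).resolve_right fun hcQ => hPU ?_
        have hle := (Ideal.span_singleton_le_iff_mem Q).2 hcQ
        rwa [le_antisymm hle ((hUmin hQ).2 hS.1.1 hle)]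
      rw [hmul, relTypeLE_span_singleton_mul_iff hc]
    · refine relTypeLE_inf_iff hN ?_ hP (relTypeLE_top hN)
      by_contra hne
      have hle : sInf U ≤ P := by
        rw [hmax.eq_of_le hne le_sup_left]
        exact le_sup_right
      have hUfin := hfin.subset hUmin
      rw [← hUfin.coe_toFinset, ← Finset.inf_id_eq_sInf, hmax.isPrime.inf_le'] at hle
      obtain ⟨Q, hQ, hQP⟩ := hle
      rw [hUfin.mem_toFinset] at hQ
      rw [id] at hQP
      exact hPU (le_antisymm (hS.1.2 (hUmin hQ).1 hQP) hQP ▸ hQ)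

end EquidimensionalComponents

lemma MvPolynomial.height_le_card {k : Type*} [Field k] {n : ℕ}
    (P : Ideal (MvPolynomial (Fin n) k)) (hP : P ≠ ⊤) : P.height ≤ n := by
  have h := Ideal.height_le_ringKrullDim_of_ne_top hP
  rw [MvPolynomial.ringKrullDim_of_isNoetherianRing, ringKrullDim_eq_zero_of_field, zero_add,
    Nat.card_eq_fintype_card, Fintype.card_fin] at h
  exact_mod_cast h

lemma MvPolynomial.isMaximal_of_height_eq {k : Type*} [Field k] {n : ℕ}
    {P : Ideal (MvPolynomial (Fin n) k)} [hP : P.IsPrime] (h : P.height = n) : P.IsMaximal := by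
  obtain ⟨M, hM, hPM⟩ := P.exists_le_maximal hP.ne_top
  rcases hPM.eq_or_lt with rfl | hlt
  · exact hM
  · have h1 : P.height + 1 ≤ M.height := 
      have := hM.isPrime
      Ideal.height_add_one_le_of_lt_of_isPrime hlt
    have h2 := MvPolynomial.height_le_card M hM.ne_top
    rw [h] at h1
    exact absurd (h1.trans h2) (by norm_cast; omega)

/-- **Proposition.** Let `I` be a proper radical ideal of `k[x₁,…,xₙ]`, `n ≥ 3`, with
equidimensional decomposition `I = I₁ ∩ … ∩ Iₙ`. Then either `rt(I) = 1`, or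
`rt(I) = rt(I₂ ∩ … ∩ I_{n-1})`, where `I_i ≠ R` for some `2 ≤ i ≤ n-1`. -/
theorem relType_equidim_decomposition {k : Type*} [Field k] {n : ℕ} (hn : 3 ≤ n)
    (I : Ideal (MvPolynomial (Fin n) k)) (hI : I ≠ ⊤) (hrad : I.IsRadical) :
    relType I = 1 ∨
      (relType I = relType (⨅ i ∈ Finset.Icc 2 (n - 1), equidimComponent I i) ∧
        ∃ i, 2 ≤ i ∧ i ≤ n - 1 ∧ equidimComponent I i ≠ ⊤) := by
  by_cases hbot : I = ⊥
  · left
    refine relType_eq_one ?_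
    have := (genInDegLE_reesKer_of_isEmpty (Fin.elim0 : Fin 0 → MvPolynomial (Fin n) k)
      1).relTypeLE le_rfl
    rwa [Set.range_eq_empty, Ideal.span_empty, ← hbot] at this
  set T : Set (Ideal (MvPolynomial (Fin n) k)) :=
    {P | P ∈ I.minimalPrimes ∧ ∃ i ∈ Finset.Icc 2 (n - 1), idealHeight P = (i : ℕ∞)} with hT
  have hTmin : T ⊆ I.minimalPrimes := fun P hP => hP.1
  have hS : ∀ N, 1 ≤ N → ∀ P ∈ I.minimalPrimes \ T,
      (∃ c ≠ 0, P = Ideal.span {c}) ∨ (P.IsMaximal ∧ RelTypeLE P N) := by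
    rintro N hN P ⟨hP, hPT⟩
    have hPprime : P.IsPrime := hP.1.1
    have hPbot : P ≠ ⊥ := by
      rintro rfl
      exact hbot (le_bot_iff.1 hP.1.2)
    have hle := MvPolynomial.height_le_card P hPprime.ne_top
    obtain ⟨h, hh⟩ := ENat.ne_top_iff_exists.1 (ne_top_of_le_ne_top (ENat.natCast_ne_top n) hle)
    rw [← hh, Nat.cast_le] at hle
    have h0 : h ≠ 0 := by
      rintro rfl
      refine hPbot ?_
      have hmin := Ideal.height_eq_zero_iff.1 hh.symm
      rwa [IsDomain.minimalPrimes_eq_singleton_bot, Set.mem_singleton_iff] at hmin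
    have h1 : ¬ (2 ≤ h ∧ h ≤ n - 1) := fun h2 =>
      hPT ⟨hP, h, Finset.mem_Icc.2 h2, by rw [idealHeight_eq_height, hh]⟩
    obtain rfl | rfl : h = 1 ∨ h = n := by omega
    · left
      obtain ⟨c, hc⟩ := UniqueFactorizationMonoid.isPrincipal_of_height_eq_one hh.symm
      refine ⟨c, ?_, hc⟩
      rintro rfl
      exact hPbot (hc.trans (by simp))
    · right
      have hmax := MvPolynomial.isMaximal_of_height_eq hh.symm
      obtain ⟨s, f, rfl, hf⟩ := exists_span_eq_genInDegLE_one k _ P hmax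
      exact ⟨hmax, (hf.mono hN).relTypeLE hN⟩
  have key : ∀ N, 1 ≤ N → (RelTypeLE I N ↔ RelTypeLE (sInf T) N) := by
    intro N hN
    have := relTypeLE_sInf_union_iff hN Set.sdiff_subset hTmin Set.disjoint_sdiff_left (hS N hN)
    rwa [Set.sdiff_union_of_subset hTmin, Ideal.sInf_minimalPrimes, hrad.radical] at this
  rcases T.eq_empty_or_nonempty with hTe | ⟨P, hP, i, hi, hPi⟩
  · left
    refine relType_eq_one ((key 1 le_rfl).2 ?_)
    rw [hTe, sInf_empty]
    exact relTypeLE_top le_rfl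
  · right
    rw [iInf_equidimComponent]
    rw [Finset.mem_Icc] at hi
    refine ⟨relType_congr key, i, hi.1, hi.2, fun htop => hP.1.1.ne_top (top_le_iff.1 ?_)⟩
    rw [← htop]
    exact sInf_le ⟨hP, hPi⟩
end
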